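/- Let β ∈ [0,1] and let f ∈ 𝒜_β have logarithmic coefficients γ_1 and γ_2. Then −1/√(5 − 6β + 2β²) ≤ |γ_2| − |γ_1| ≤ 1/(3 − 2β). Both inequalities are sharp. -/

import Mathlib

open Metric Filter Set

/-- The class `𝒜_β`: analytic `f(z) = z + ∑_{n≥2} aₙ zⁿ` on the unit disk with
`Re (β f(z)/z + (1-β) f'(z)) > 0`. -/
def IsAbeta (β : ℝ) (a : ℕ → ℂ) (f : ℂ → ℂ) : Prop :=
  a 0 = 0 ∧ a 1 = 1 ∧
  (∀ z ∈ Metric.ball (0 : ℂ) 1, HasSum (fun n => a n * z ^ n) (f z)) ∧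
  ∀ z ∈ Metric.ball (0 : ℂ) 1, z ≠ 0 →
    0 < ((β : ℂ) * f z / z + (1 - (β : ℂ)) * deriv f z).re

open scoped Topology ComplexConjugate

theorem hasFPowerSeriesOnBall_ofScalars {a : ℕ → ℂ} {f : ℂ → ℂ}
    (h : ∀ z ∈ ball (0 : ℂ) 1, HasSum (fun n => a n * z ^ n) (f z)) :
    HasFPowerSeriesOnBall f (FormalMultilinearSeries.ofScalars ℂ a) 0 1 := by
  refine ⟨?_, one_pos, fun {y} hy => ?_⟩
  · refine ENNReal.le_of_forall_nnreal_lt fun r hr => ?_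
    have hr1 : r < 1 := by exact_mod_cast hr
    refine FormalMultilinearSeries.le_radius_of_tendsto _ (l := 0) ?_
    have hs := (h (r : ℂ) (by simpa using hr1)).summable.tendsto_atTop_zero.norm
    simpa using hs
  · have hy1 : y ∈ ball (0 : ℂ) 1 := by
      rw [← eball_ofReal]
      simpa using hy
    simpa [FormalMultilinearSeries.ofScalars_apply_eq, mul_comm] using h y hy1

theorem hasSum_deriv_of_hasSum {a : ℕ → ℂ} {f : ℂ → ℂ}
    (h : ∀ z ∈ ball (0 : ℂ) 1, HasSum (fun n => a n * z ^ n) (f z)) {z : ℂ}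
    (hz : z ∈ ball (0 : ℂ) 1) :
    HasSum (fun n : ℕ => (n + 1) * a (n + 1) * z ^ n) (deriv f z) := by
  have hz' : z ∈ eball (0 : ℂ) 1 := by
    rw [← eball_ofReal] at hz
    simpa using hz
  have h1 := ((hasFPowerSeriesOnBall_ofScalars h).fderiv.hasSum hz').mapL
    (ContinuousLinearMap.apply ℂ ℂ (1 : ℂ))
  simpa [Function.comp_def, FormalMultilinearSeries.apply_eq_pow_smul_coeff,
    mul_comm] using h1

/-- The Schwarz–Pick inequality at the centre of the unit disk. -/
theorem norm_deriv_zero_le_one_sub_sq {φ : ℂ → ℂ} (hd : DifferentiableOn ℂ φ (ball 0 1))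
    (hφ : ∀ z ∈ ball (0 : ℂ) 1, ‖φ z‖ ≤ 1) : ‖deriv φ 0‖ ≤ 1 - ‖φ 0‖ ^ 2 := by
  have h0 : (0 : ℂ) ∈ ball (0 : ℂ) 1 := by simp
  have hnhds : ball (0 : ℂ) 1 ∈ 𝓝 (0 : ℂ) := isOpen_ball.mem_nhds h0
  rcases (hφ 0 h0).eq_or_lt with h1 | h1
  · have hmax : IsLocalMax (norm ∘ φ) 0 := by
      filter_upwards [hnhds] with z hz
      simpa [h1] using hφ z hz
    have hev : φ =ᶠ[𝓝 0] fun _ => φ 0 :=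
      Complex.eventually_eq_of_isLocalMax_norm
        (by filter_upwards [isOpen_ball.eventually_mem h0] with z hz
            exact hd.differentiableAt (isOpen_ball.mem_nhds hz)) hmax
    simp [hev.deriv_eq, h1]
  set w := φ 0 with hw
  have hden : ∀ z ∈ ball (0 : ℂ) 1, 1 - conj w * φ z ≠ 0 := by
    intro z hz h
    have h2 : ‖conj w * φ z‖ = 1 := by rw [← sub_eq_zero.mp h]; simp
    have h3 : ‖conj w * φ z‖ < 1 := by
      rw [norm_mul, Complex.norm_conj]
      nlinarith [hφ z hz, norm_nonneg w, norm_nonneg (φ z)]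
    linarith
  have hmaps : MapsTo (fun z => (φ z - w) / (1 - conj w * φ z)) (ball 0 1)
      (closedBall ((φ 0 - w) / (1 - conj w * φ 0)) 1) := by
    intro z hz
    have hz1 := hφ z hz
    simp only [← hw, sub_self, zero_div, mem_closedBall, dist_zero_right, norm_div]
    refine div_le_one_of_le₀ ?_ (norm_nonneg _)
    refine (sq_le_sq₀ (norm_nonneg _) (norm_nonneg _)).mp ?_
    have key : ‖1 - conj w * φ z‖ ^ 2 - ‖φ z - w‖ ^ 2 = (1 - ‖w‖ ^ 2) * (1 - ‖φ z‖ ^ 2) := by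
      simp only [← Complex.normSq_eq_norm_sq, Complex.normSq_apply]
      simp
      ring
    have : 0 ≤ (1 - ‖w‖ ^ 2) * (1 - ‖φ z‖ ^ 2) := by
      apply mul_nonneg <;> nlinarith [norm_nonneg w, norm_nonneg (φ z)]
    linarith
  have hD := (hd.differentiableAt hnhds).hasDerivAt
  have hder := (hD.sub_const w).div ((hD.const_mul (conj w)).const_sub 1) (hden 0 h0)
  have hS := Complex.norm_deriv_le_one_of_mapsTo_ball (R := 1)
    ((hd.sub_const w).div ((hd.const_mul (conj w)).const_sub 1) hden) hmaps one_pos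
  have hden' : 1 - conj w * w = ((1 - ‖w‖ ^ 2 : ℝ) : ℂ) := by
    rw [mul_comm, Complex.mul_conj, Complex.normSq_eq_norm_sq]; push_cast; rfl
  have hpos : 0 < 1 - ‖w‖ ^ 2 := by nlinarith [norm_nonneg w]
  have hval : deriv (fun z => (φ z - w) / (1 - conj w * φ z)) 0
      = deriv φ 0 / ((1 - ‖w‖ ^ 2 : ℝ) : ℂ) := by
    refine hder.deriv.trans ?_
    rw [← hw, hden']
    have : ((1 - ‖w‖ ^ 2 : ℝ) : ℂ) ≠ 0 := by exact_mod_cast hpos.ne'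
    field_simp
    simp
  have hS' : ‖deriv (fun z => (φ z - w) / (1 - conj w * φ z)) 0‖ ≤ 1 := hS
  rwa [hval, norm_div, Complex.norm_real, Real.norm_of_nonneg hpos.le, div_le_one hpos] at hS'

/-- The first two coefficients of a function with positive real part on the unit disk. -/
theorem exists_coeff_param_of_re_pos {c : ℕ → ℂ} {q : ℂ → ℂ} (hc : c 0 = 1)
    (h : ∀ z ∈ ball (0 : ℂ) 1, HasSum (fun n => c n * z ^ n) (q z))
    (hre : ∀ z ∈ ball (0 : ℂ) 1, 0 < (q z).re) :
    ∃ w₁ w₂ : ℂ, c 1 = 2 * w₁ ∧ c 2 = 2 * (w₂ + w₁ ^ 2) ∧ ‖w₂‖ ≤ 1 - ‖w₁‖ ^ 2 := by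
  have h0 : (0 : ℂ) ∈ ball (0 : ℂ) 1 := by simp
  have hnhds : ball (0 : ℂ) 1 ∈ 𝓝 (0 : ℂ) := isOpen_ball.mem_nhds h0
  have hp := hasFPowerSeriesOnBall_ofScalars h
  have hqd : DifferentiableOn ℂ q (ball 0 1) := by
    have := hp.differentiableOn
    rwa [← ENNReal.ofReal_one, eball_ofReal] at this
  have hq0 : q 0 = 1 := by
    refine (h 0 h0).unique ?_
    convert hasSum_single (f := fun n => c n * (0 : ℂ) ^ n) 0 (fun n hn => by simp [hn]) using 1
    simp [hc]
  have hqderiv : deriv q 0 = c 1 := by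
    simpa [FormalMultilinearSeries.ofScalars_apply_eq] using hp.hasFPowerSeriesAt.deriv
  set r := dslope q 0 with hr
  have hrd : DifferentiableOn ℂ r (ball 0 1) := (Complex.differentiableOn_dslope hnhds).mpr hqd
  have hr0 : r 0 = c 1 := by rw [hr, dslope_same, hqderiv]
  have hrderiv : deriv r 0 = c 2 := by
    have := hp.hasFPowerSeriesAt.has_fpower_series_dslope_fslope.deriv
    simpa [FormalMultilinearSeries.apply_eq_pow_smul_coeff] using this
  have hqr : ∀ z, q z - 1 = z * r z := fun z => by
    simpa [hq0] using (sub_smul_dslope q 0 z).symm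
  have hne : ∀ z ∈ ball (0 : ℂ) 1, q z + 1 ≠ 0 := fun z hz h => by
    have := congrArg Complex.re h
    simp at this
    linarith [hre z hz]
  have hd : DifferentiableOn ℂ (fun z => r z / (q z + 1)) (ball 0 1) :=
    hrd.div (hqd.add_const 1) hne
  have hwd : DifferentiableOn ℂ (fun z => z * (r z / (q z + 1))) (ball 0 1) :=
    differentiableOn_id.mul hd
  have hmaps : MapsTo (fun z => z * (r z / (q z + 1))) (ball 0 1) (closedBall 0 1) := by
    intro z hz
    have hz1 := hre z hz
    simp only [mul_div_assoc', ← hqr, mem_closedBall, dist_zero_right, norm_div]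
    refine div_le_one_of_le₀ ?_ (norm_nonneg _)
    refine (sq_le_sq₀ (norm_nonneg _) (norm_nonneg _)).mp ?_
    simp only [← Complex.normSq_eq_norm_sq, Complex.normSq_apply]
    simp
    nlinarith
  have hbound : ∀ z ∈ ball (0 : ℂ) 1, ‖r z / (q z + 1)‖ ≤ 1 := by
    intro z hz
    rcases eq_or_ne z 0 with rfl | hz0
    · have h1 := (hasDerivAt_id (0 : ℂ)).mul (hd.differentiableAt hnhds).hasDerivAt
      have h2 := Complex.norm_deriv_le_one_of_mapsTo_ball hwd (by simpa using hmaps) one_pos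
      have h3 : deriv (fun z => z * (r z / (q z + 1))) 0 = r 0 / (q 0 + 1) := by
        refine h1.deriv.trans ?_
        simp
      rwa [h3] at h2
    · have h1 := Complex.norm_le_norm_of_mapsTo_ball hwd hmaps (by simp) (by simpa using hz)
      rw [norm_mul] at h1
      exact (mul_le_iff_le_one_right (norm_pos_iff.mpr hz0)).mp h1
  have hder := ((hrd.differentiableAt hnhds).hasDerivAt).div
    ((hqd.differentiableAt hnhds).hasDerivAt.add_const 1) (hne 0 h0)
  refine ⟨r 0 / (q 0 + 1), deriv (fun z => r z / (q z + 1)) 0, ?_, ?_,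
    norm_deriv_zero_le_one_sub_sq hd hbound⟩
  · rw [hr0, hq0]; ring
  · have h3 : deriv (fun z => r z / (q z + 1)) 0 = _ := hder.deriv
    rw [h3, hrderiv, hqderiv, hr0, hq0]
    ring

theorem hasSum_mul_div_add_mul_deriv {a : ℕ → ℂ} {f : ℂ → ℂ} (ha : a 0 = 0)
    (h : ∀ z ∈ ball (0 : ℂ) 1, HasSum (fun n => a n * z ^ n) (f z)) (β : ℂ) {z : ℂ}
    (hz : z ∈ ball (0 : ℂ) 1) (hz0 : z ≠ 0) :
    HasSum (fun n : ℕ => (β + (1 - β) * (n + 1)) * a (n + 1) * z ^ n)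
      (β * f z / z + (1 - β) * deriv f z) := by
  have h1 : HasSum (fun n : ℕ => a (n + 1) * z ^ (n + 1)) (f z) := by
    simpa [ha] using (hasSum_nat_add_iff' 1).mpr (h z hz)
  convert! (h1.mul_left (β / z)).add ((hasSum_deriv_of_hasSum h hz).mul_left (1 - β)) using 1
  · funext n
    field_simp
    ring
  · ring

theorem exists_coeff_param_of_isAbeta {β : ℝ} {a : ℕ → ℂ} {f : ℂ → ℂ} (hf : IsAbeta β a f) :
    ∃ w₁ w₂ : ℂ, (2 - β) * a 2 = 2 * w₁ ∧ (3 - 2 * β) * a 3 = 2 * (w₂ + w₁ ^ 2) ∧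
      ‖w₂‖ ≤ 1 - ‖w₁‖ ^ 2 := by
  obtain ⟨ha0, ha1, hs, hre⟩ := hf
  obtain ⟨w₁, w₂, h1, h2, h3⟩ := exists_coeff_param_of_re_pos
    (c := fun n => ((β : ℂ) + (1 - β) * (n + 1)) * a (n + 1))
    (q := fun z => if z = 0 then 1 else (β : ℂ) * f z / z + (1 - β) * deriv f z)
    (by simp [ha1])
    (by
      intro z hz
      by_cases hz0 : z = 0
      · subst hz0
        convert hasSum_single (f := fun n : ℕ =>
          ((β : ℂ) + (1 - β) * (n + 1)) * a (n + 1) * (0 : ℂ) ^ n) 0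
          (fun n hn => by simp [hn]) using 1
        simp [ha1]
      · simpa [hz0] using hasSum_mul_div_add_mul_deriv ha0 hs β hz hz0)
    (by
      intro z hz
      by_cases hz0 : z = 0
      · simp [hz0]
      · simpa [hz0] using hre z hz hz0)
  refine ⟨w₁, w₂, ?_, ?_, h3⟩
  · rw [← h1]; push_cast; ring
  · rw [← h2]; push_cast; ring

theorem half_lt_re_inv_one_sub {u : ℂ} (hu : ‖u‖ < 1) : 1 / 2 < ((1 - u)⁻¹).re := by
  have hne : (1 : ℂ) - u ≠ 0 := fun h => by
    rw [← sub_eq_zero.mp h] at hu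
    simp at hu
  have hpos := Complex.normSq_pos.mpr hne
  rw [Complex.inv_re, lt_div_iff₀ hpos]
  have h2 : ‖u‖ ^ 2 < 1 := by nlinarith [norm_nonneg u]
  rw [← Complex.normSq_eq_norm_sq, Complex.normSq_apply] at h2
  simp only [Complex.normSq_apply, Complex.sub_re, Complex.one_re, Complex.sub_im, Complex.one_im]
  nlinarith

/-- Functions of `𝒜_β` built from the half-sum of two conjugate Herglotz kernels. -/
theorem exists_isAbeta_coeff {β t : ℝ} (hβ : β ∈ Icc (0 : ℝ) 1) (ht : t ^ 2 ≤ 1) :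
    ∃ b g, IsAbeta β b g ∧ b 2 = 2 * t / (2 - β) ∧ b 3 = 2 * (2 * t ^ 2 - 1) / (3 - 2 * β) := by
  obtain ⟨hβ0, hβ1⟩ := hβ
  set ζ : ℂ := ⟨t, √(1 - t ^ 2)⟩ with hζ
  have hsq : √(1 - t ^ 2) * √(1 - t ^ 2) = 1 - t ^ 2 := Real.mul_self_sqrt (by linarith)
  have hadd : ζ + conj ζ = 2 * t := by
    apply Complex.ext <;> simp [hζ, two_mul]
  have hmul : ζ * conj ζ = 1 := by
    rw [Complex.mul_conj, Complex.normSq_apply]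
    simp only [hζ, hsq]
    push_cast
    ring
  have hnorm : ‖ζ‖ = 1 := by
    have h1 := congrArg norm hmul
    rw [norm_mul, Complex.norm_conj, norm_one] at h1
    nlinarith [norm_nonneg ζ]
  set c : ℕ → ℂ := fun n => ζ ^ n + conj ζ ^ n - if n = 0 then 1 else 0 with hc
  set b : ℕ → ℂ := fun n => if n = 0 then 0 else c (n - 1) / (β + (1 - β) * n) with hb
  have hden : ∀ n : ℕ, 1 ≤ ‖(β : ℂ) + (1 - β) * (n + 1)‖ := by
    intro n
    have h1 : (β : ℂ) + (1 - β) * (n + 1) = ((1 + (1 - β) * n : ℝ) : ℂ) := by push_cast; ring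
    rw [h1, Complex.norm_real]
    exact le_trans (le_add_of_nonneg_right (mul_nonneg (by linarith) (Nat.cast_nonneg n)))
      (le_abs_self _)
  have hden0 : ∀ n : ℕ, (β : ℂ) + (1 - β) * (n + 1) ≠ 0 := fun n =>
    norm_pos_iff.mp (one_pos.trans_le (hden n))
  have hcsum : ∀ z ∈ ball (0 : ℂ) 1, HasSum (fun n => c n * z ^ n)
      ((1 - ζ * z)⁻¹ + (1 - conj ζ * z)⁻¹ - 1) := by
    intro z hz
    have hz1 : ‖z‖ < 1 := by simpa using hz
    have h1 := hasSum_geometric_of_norm_lt_one (ξ := ζ * z) (by simpa [hnorm] using hz1)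
    have h2 := hasSum_geometric_of_norm_lt_one (ξ := conj ζ * z) (by simpa [hnorm] using hz1)
    have h3 : HasSum (fun n : ℕ => if n = 0 then (1 : ℂ) else 0) 1 := hasSum_ite_eq 0 1
    convert! (h1.add h2).sub h3 using 1
    funext n
    rcases n with _ | n
    · simp [hc]
    · simp [hc, mul_pow]
      ring
  have hbc : ∀ n : ℕ, ((β : ℂ) + (1 - β) * (n + 1)) * b (n + 1) = c n := by
    intro n
    simp only [hb, Nat.add_eq_zero_iff, one_ne_zero, and_false, if_false, Nat.add_sub_cancel,
      Nat.cast_add, Nat.cast_one]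
    exact mul_div_cancel₀ _ (hden0 n)
  have hbsum : ∀ z ∈ ball (0 : ℂ) 1, HasSum (fun n => b n * z ^ n) (∑' n, b n * z ^ n) := by
    intro z hz
    refine Summable.hasSum ?_
    rw [← summable_nat_add_iff 1]
    refine Summable.of_norm_bounded (g := fun n => ‖c n * z ^ n‖) (hcsum z hz).summable.norm ?_
    intro n
    have hz1 : ‖z‖ < 1 := by simpa using hz
    rw [← hbc n, pow_succ, norm_mul, norm_mul, norm_mul, norm_mul]
    have h4 : ‖b (n + 1)‖ ≤ ‖(β : ℂ) + (1 - β) * (n + 1)‖ * ‖b (n + 1)‖ :=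
      le_mul_of_one_le_left (norm_nonneg _) (hden n)
    exact mul_le_mul h4 (mul_le_of_le_one_right (norm_nonneg _) hz1.le) (by positivity)
      (by positivity)
  refine ⟨b, fun z => ∑' n, b n * z ^ n, ⟨by simp [hb], by simp [hb, hc], hbsum, ?_⟩, ?_, ?_⟩
  · intro z hz hz0
    have hz1 : ‖z‖ < 1 := by simpa using hz
    have h1 := hasSum_mul_div_add_mul_deriv (by simp [hb]) hbsum β hz hz0
    simp only [hbc] at h1
    rw [h1.unique (hcsum z hz)]
    have h2 := half_lt_re_inv_one_sub (u := ζ * z) (by simpa [hnorm] using hz1)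
    have h3 := half_lt_re_inv_one_sub (u := conj ζ * z) (by simpa [hnorm] using hz1)
    rw [Complex.sub_re, Complex.add_re, Complex.one_re]
    linarith
  · have h1 : b 2 = (ζ + conj ζ) / (β + (1 - β) * 2) := by simp [hb, hc]
    rw [h1, hadd]
    ring
  · have h1 : b 3 = (ζ ^ 2 + conj ζ ^ 2) / (β + (1 - β) * 3) := by simp [hb, hc]
    have h2 : ζ ^ 2 + conj ζ ^ 2 = 2 * (2 * t ^ 2 - 1) := by
      linear_combination (ζ + conj ζ + 2 * t) * hadd - 2 * hmul
    rw [h1, h2]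
    ring

theorem logCoeff_two_eq {β : ℝ} (hβ : β ≤ 1) {x y w₁ w₂ : ℂ}
    (h1 : (2 - β) * x = 2 * w₁) (h2 : (3 - 2 * β) * y = 2 * (w₂ + w₁ ^ 2)) :
    x / 2 = w₁ / ((2 - β : ℝ) : ℂ) ∧ (y - x ^ 2 / 2) / 2 =
      w₂ / ((3 - 2 * β : ℝ) : ℂ) +
        w₁ ^ 2 * (((1 - β) ^ 2 / ((2 - β) ^ 2 * (3 - 2 * β)) : ℝ) : ℂ) := by
  have hA : (2 - β : ℂ) ≠ 0 := by exact_mod_cast (by linarith : (0 : ℝ) < 2 - β).ne'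
  have hB : (3 - 2 * β : ℂ) ≠ 0 := by exact_mod_cast (by linarith : (0 : ℝ) < 3 - 2 * β).ne'
  have hx : x = 2 * w₁ / (2 - β) := by rw [← h1, mul_div_cancel_left₀ _ hA]
  have hy : y = 2 * (w₂ + w₁ ^ 2) / (3 - 2 * β) := by rw [← h2, mul_div_cancel_left₀ _ hB]
  push_cast
  constructor
  · rw [hx]; ring
  · rw [hx, hy]
    field_simp
    ring

theorem logCoeff_diff_le {β s t m : ℝ} (hβ : β ∈ Icc (0 : ℝ) 1) (ht : 0 ≤ t) (hs : s ≤ 1 - t ^ 2)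
    (hm : m ≤ s / (3 - 2 * β) + t ^ 2 * ((1 - β) ^ 2 / ((2 - β) ^ 2 * (3 - 2 * β)))) :
    m - t / (2 - β) ≤ 1 / (3 - 2 * β) := by
  obtain ⟨hβ0, hβ1⟩ := hβ
  have hA : 0 < 2 - β := by linarith
  have hB : 0 < 3 - 2 * β := by linarith
  have h1 : 0 ≤ t / (2 - β) := by positivity
  have h2 : s / (3 - 2 * β) ≤ (1 - t ^ 2) / (3 - 2 * β) := by gcongr
  have h3 : (1 - β) ^ 2 / ((2 - β) ^ 2 * (3 - 2 * β)) ≤ 1 / (3 - 2 * β) := by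
    rw [div_le_div_iff₀ (by positivity) hB]
    nlinarith
  have h4 := mul_le_mul_of_nonneg_left h3 (sq_nonneg t)
  have h5 : (1 - t ^ 2) / (3 - 2 * β) + t ^ 2 * (1 / (3 - 2 * β)) = 1 / (3 - 2 * β) := by ring
  linarith

theorem neg_le_logCoeff_diff {β s t m : ℝ} (hβ : β ∈ Icc (0 : ℝ) 1) (hs : s ≤ 1 - t ^ 2)
    (hm0 : 0 ≤ m)
    (hm : t ^ 2 * ((1 - β) ^ 2 / ((2 - β) ^ 2 * (3 - 2 * β))) - s / (3 - 2 * β) ≤ m) :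
    -(1 / √(5 - 6 * β + 2 * β ^ 2)) ≤ m - t / (2 - β) := by
  obtain ⟨hβ0, hβ1⟩ := hβ
  have hA : 0 < 2 - β := by linarith
  have hB : 0 < 3 - 2 * β := by linarith
  have hD : 0 < 5 - 6 * β + 2 * β ^ 2 := by nlinarith
  set R := √(5 - 6 * β + 2 * β ^ 2) with hR
  have hRpos : 0 < R := Real.sqrt_pos.mpr hD
  have hRsq : R ^ 2 = 5 - 6 * β + 2 * β ^ 2 := Real.sq_sqrt hD.le
  obtain ⟨u, rfl⟩ : ∃ u, t = u * (2 - β) / R := ⟨t * R / (2 - β), by field_simp⟩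
  have hu : u * (2 - β) / R / (2 - β) = u / R := by field_simp
  rw [hu]
  rcases le_total u 1 with hu1 | hu1
  · have : u / R ≤ 1 / R := by gcongr
    linarith
  have h2 : s / (3 - 2 * β) ≤ (1 - (u * (2 - β) / R) ^ 2) / (3 - 2 * β) := by gcongr
  have h3 : (u * (2 - β) / R) ^ 2 * ((1 - β) ^ 2 / ((2 - β) ^ 2 * (3 - 2 * β)))
      - (1 - (u * (2 - β) / R) ^ 2) / (3 - 2 * β) = (u ^ 2 - 1) / (3 - 2 * β) := by
    field_simp
    rw [hRsq]
    ring
  have hBR : 3 - 2 * β ≤ 2 * R := by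
    refine (sq_le_sq₀ hB.le (by positivity)).mp ?_
    rw [mul_pow, hRsq]
    nlinarith
  have h4 : 0 ≤ (u ^ 2 - 1) / (3 - 2 * β) - u / R + 1 / R := by
    have : (u ^ 2 - 1) / (3 - 2 * β) - u / R + 1 / R
        = (u - 1) * ((u + 1) * R - (3 - 2 * β)) / ((3 - 2 * β) * R) := by
      field_simp
      ring
    rw [this]
    exact div_nonneg (mul_nonneg (by linarith) (by nlinarith)) (by positivity)
  linarith

theorem stmt6 (β : ℝ) (hβ : β ∈ Set.Icc (0 : ℝ) 1)
    (a : ℕ → ℂ) (f : ℂ → ℂ) (hf : IsAbeta β a f) :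
    -- with `γ₁ = a₂/2` and `γ₂ = (a₃ - a₂²/2)/2`
    (-(1 / Real.sqrt (5 - 6 * β + 2 * β ^ 2))
        ≤ ‖(a 3 - (a 2) ^ 2 / 2) / 2‖ - ‖a 2 / 2‖ ∧
      ‖(a 3 - (a 2) ^ 2 / 2) / 2‖ - ‖a 2 / 2‖ ≤ 1 / (3 - 2 * β)) ∧
    -- sharpness of the upper bound
    (∃ b g, IsAbeta β b g ∧
      ‖(b 3 - (b 2) ^ 2 / 2) / 2‖ - ‖b 2 / 2‖ = 1 / (3 - 2 * β)) ∧
    -- sharpness of the lower bound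
    (∃ b g, IsAbeta β b g ∧
      ‖(b 3 - (b 2) ^ 2 / 2) / 2‖ - ‖b 2 / 2‖
        = -(1 / Real.sqrt (5 - 6 * β + 2 * β ^ 2))) := by
  have hA : 0 < 2 - β := by linarith [hβ.2]
  have hB : 0 < 3 - 2 * β := by linarith [hβ.2]
  refine ⟨?_, ?_, ?_⟩
  · obtain ⟨w₁, w₂, h1, h2, h3⟩ := exists_coeff_param_of_isAbeta hf
    obtain ⟨e1, e2⟩ := logCoeff_two_eq hβ.2 h1 h2
    set E := (1 - β) ^ 2 / ((2 - β) ^ 2 * (3 - 2 * β)) with hE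
    have hE0 : 0 ≤ E := by positivity
    have n1 : ‖w₂ / ((3 - 2 * β : ℝ) : ℂ)‖ = ‖w₂‖ / (3 - 2 * β) := by
      rw [norm_div, Complex.norm_real, Real.norm_of_nonneg hB.le]
    have n2 : ‖w₁ ^ 2 * (E : ℂ)‖ = ‖w₁‖ ^ 2 * E := by
      rw [norm_mul, norm_pow, Complex.norm_real, Real.norm_of_nonneg hE0]
    rw [e2, e1, norm_div w₁, Complex.norm_real, Real.norm_of_nonneg hA.le]
    refine ⟨neg_le_logCoeff_diff hβ h3 (norm_nonneg _) ?_,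
      logCoeff_diff_le hβ (norm_nonneg _) h3 ?_⟩
    · rw [← n1, ← n2, add_comm]
      exact norm_sub_le_norm_add _ _
    · rw [← n1, ← n2]
      exact norm_add_le _ _
  · obtain ⟨b, g, hbg, h2, h3⟩ := exists_isAbeta_coeff (t := 0) hβ (by norm_num)
    refine ⟨b, g, hbg, ?_⟩
    have e : (b 3 - b 2 ^ 2 / 2) / 2 = ((-(1 / (3 - 2 * β)) : ℝ) : ℂ) := by
      rw [h2, h3]
      push_cast
      ring
    rw [e, h2, Complex.norm_real, norm_neg, Real.norm_of_nonneg (by positivity)]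
    simp
  · have hD : 0 < 5 - 6 * β + 2 * β ^ 2 := by nlinarith [hβ.1, hβ.2]
    set R := √(5 - 6 * β + 2 * β ^ 2) with hR
    have hRpos : 0 < R := Real.sqrt_pos.mpr hD
    have hRsq : R ^ 2 = 5 - 6 * β + 2 * β ^ 2 := Real.sq_sqrt hD.le
    have ht : ((2 - β) / R) ^ 2 ≤ 1 := by
      rw [div_pow, hRsq, div_le_one hD]
      nlinarith [sq_nonneg (1 - β)]
    obtain ⟨b, g, hbg, h2, h3⟩ := exists_isAbeta_coeff hβ ht
    refine ⟨b, g, hbg, ?_⟩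
    have hRC : (R : ℂ) ^ 2 = 5 - 6 * β + 2 * β ^ 2 := by exact_mod_cast hRsq
    have hRC0 : (R : ℂ) ≠ 0 := by exact_mod_cast hRpos.ne'
    have hAC : (2 - β : ℂ) ≠ 0 := by exact_mod_cast hA.ne'
    have hBC : (3 - 2 * β : ℂ) ≠ 0 := by exact_mod_cast hB.ne'
    have e2 : b 2 / 2 = ((1 / R : ℝ) : ℂ) := by
      rw [h2]
      push_cast
      field_simp
    have e3 : (b 3 - b 2 ^ 2 / 2) / 2 = 0 := by
      rw [h2, h3]
      push_cast
      field_simp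
      rw [hRC]
      ring
    rw [e2, e3, Complex.norm_real, Real.norm_of_nonneg (by positivity)]
    simp
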